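/- Let a > 0 and let g : [0, a] → ℂ be continuous. Then lim_{ε → 0+} i·ε · ∫_0^a g(u)/(u − i·ε)² du = − g(0). (This is the boundary limit lim_{z→0} z·(d/dz)∫_0^a g(u)/(u − z) du = −g(0) computed along the imaginary direction; it is the scalar content of the local parametrix computation lim_{z→0} z·(dC^{(0)}/dz)·(C^{(0)})^{−1} for the explicit triangular parametrix built from the Cauchy transform of e^{−2sĝ}.) -/

import Mathlib

open MeasureTheory Filter Polynomial

noncomputable section

theorem Complex.ofReal_sub_I_ne_zero (t : ℝ) : (t : ℂ) - Complex.I ≠ 0 := by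
  intro h
  simpa using congrArg Complex.im h

theorem Complex.norm_ofReal_sub_I_sq (t : ℝ) : ‖((t : ℂ) - Complex.I) ^ 2‖ = 1 + t ^ 2 := by
  rw [norm_pow, ← Complex.normSq_eq_norm_sq, Complex.normSq_apply]
  simp
  ring

theorem integrable_inv_ofReal_sub_I_sq :
    Integrable (fun t : ℝ => (((t : ℂ) - Complex.I) ^ 2)⁻¹) := by
  refine integrable_inv_one_add_sq.mono' ?_ (ae_of_all _ fun t => ?_)
  · exact (by fun_prop : Measurable fun t : ℝ =>
      (((t : ℂ) - Complex.I) ^ 2)⁻¹).aestronglyMeasurable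
  · rw [norm_inv, Complex.norm_ofReal_sub_I_sq]

theorem integral_Ioi_inv_ofReal_sub_I_sq :
    ∫ t : ℝ in Set.Ioi 0, (((t : ℂ) - Complex.I) ^ 2)⁻¹ = Complex.I := by
  have hderiv : ∀ t ∈ Set.Ici (0 : ℝ), HasDerivAt (fun t : ℝ => -((t : ℂ) - Complex.I)⁻¹)
      (((t : ℂ) - Complex.I) ^ 2)⁻¹ t := by
    intro t _
    have h := (((Complex.ofRealCLM.hasDerivAt (x := t)).sub_const Complex.I).inv
      (Complex.ofReal_sub_I_ne_zero t)).neg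
    refine HasDerivAt.congr_deriv h ?_
    simp [neg_div]
  have hlim : Tendsto (fun t : ℝ => -((t : ℂ) - Complex.I)⁻¹) atTop (nhds 0) := by
    rw [← neg_zero]
    refine (tendsto_inv₀_cobounded.comp ?_).neg
    rw [← tendsto_norm_atTop_iff_cobounded]
    refine tendsto_atTop_mono (fun t => ?_) tendsto_id
    simpa using (Complex.re_le_norm ((t : ℂ) - Complex.I))
  rw [integral_Ioi_of_hasDerivAt_of_tendsto' hderiv
    integrable_inv_ofReal_sub_I_sq.integrableOn hlim]
  simp

/-- The rescaling `u = εt` of the Cauchy-type integral, for a density vanishing outside `[0, a]`. -/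
theorem mul_integral_div_sub_sq_eq_integral_Ioi {a ε : ℝ} (ha : 0 < a) (hε : 0 < ε) (g : ℝ → ℂ) :
    (ε : ℂ) * ∫ u in (0 : ℝ)..a, g u / ((u : ℂ) - Complex.I * ε) ^ 2 =
      ∫ t in Set.Ioi 0, (Set.Icc 0 a).indicator g (ε * t) * (((t : ℂ) - Complex.I) ^ 2)⁻¹ := by
  have hεC : (ε : ℂ) ≠ 0 := by exact_mod_cast hε.ne'
  have hset : ∫ u in (0 : ℝ)..a, g u / ((u : ℂ) - Complex.I * ε) ^ 2 =
      ∫ u in Set.Ioi 0, (Set.Icc 0 a).indicator g u / ((u : ℂ) - Complex.I * ε) ^ 2 := by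
    rw [intervalIntegral.integral_of_le ha.le]
    refine (setIntegral_congr_fun measurableSet_Ioc fun u hu => ?_).trans
      (setIntegral_eq_of_subset_of_forall_sdiff_eq_zero measurableSet_Ioi
        Set.Ioc_subset_Ioi_self fun u hu => ?_).symm
    · simp [Set.indicator_of_mem (Set.Ioc_subset_Icc_self hu)]
    · have : u ∉ Set.Icc 0 a := fun h => hu.2 ⟨hu.1, h.2⟩
      simp [Set.indicator_of_notMem this]
  have hscale := integral_comp_mul_left_Ioi
    (fun u : ℝ => (Set.Icc 0 a).indicator g u / ((u : ℂ) - Complex.I * ε) ^ 2) 0 hε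
  rw [mul_zero] at hscale
  have hsub : ∫ u in Set.Ioi 0, (Set.Icc 0 a).indicator g u / ((u : ℂ) - Complex.I * ε) ^ 2 =
      ε * ∫ t in Set.Ioi 0,
        (Set.Icc 0 a).indicator g (ε * t) / (((ε * t : ℝ) : ℂ) - Complex.I * ε) ^ 2 := by
    rw [hscale, Complex.real_smul, Complex.ofReal_inv, mul_inv_cancel_left₀ hεC]
  rw [hset, hsub, ← mul_assoc, ← integral_const_mul]
  congr 1 with t
  have ht := Complex.ofReal_sub_I_ne_zero t
  have : ((ε * t : ℝ) : ℂ) - Complex.I * ε = ε * (t - Complex.I) := by push_cast; ring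
  rw [this]
  field_simp

/-- The boundary limit of the Cauchy-type integral appearing in the local
parametrix computation: `iε·∫₀ᵃ g(u)/(u - iε)² du → -g(0)` as `ε → 0⁺`. -/
theorem cauchy_transform_boundary_limit
    (a : ℝ) (ha : 0 < a) (g : ℝ → ℂ) (hg : ContinuousOn g (Set.Icc 0 a)) :
    Tendsto
      (fun ε : ℝ =>
        Complex.I * (ε : ℂ) * ∫ u in (0 : ℝ)..a, g u / ((u : ℂ) - Complex.I * ε) ^ 2)
      (nhdsWithin 0 (Set.Ioi 0)) (nhds (-g 0)) := by
  obtain ⟨M, hM⟩ := isCompact_Icc.exists_bound_of_continuousOn hg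
  set h : ℝ → ℂ := (Set.Icc 0 a).indicator g with hh
  have hmeas : Measurable h := by
    rw [hh, ← Set.piecewise_eq_indicator]
    exact hg.measurable_piecewise continuousOn_const measurableSet_Icc
  have hbound : ∀ u, ‖h u‖ ≤ M := by
    intro u
    by_cases hu : u ∈ Set.Icc 0 a
    · simpa [hh, Set.indicator_of_mem hu] using hM u hu
    · simpa [hh, Set.indicator_of_notMem hu] using
        (norm_nonneg _).trans (hM 0 (Set.left_mem_Icc.2 ha.le))
  have hzero : Tendsto h (nhdsWithin 0 (Set.Ioi 0)) (nhds (g 0)) := by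
    have hIoc : Tendsto g (nhdsWithin 0 (Set.Ioc 0 a)) (nhds (g 0)) :=
      (hg 0 (Set.left_mem_Icc.2 ha.le)).mono_left (nhdsWithin_mono _ Set.Ioc_subset_Icc_self)
    rw [nhdsWithin_Ioc_eq_nhdsGT ha] at hIoc
    refine hIoc.congr' ?_
    filter_upwards [Ioc_mem_nhdsGT ha] with u hu
    rw [hh, Set.indicator_of_mem (Set.Ioc_subset_Icc_self hu)]
  have hlim : Tendsto
      (fun ε : ℝ => ∫ t in Set.Ioi 0, h (ε * t) * (((t : ℂ) - Complex.I) ^ 2)⁻¹)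
      (nhdsWithin 0 (Set.Ioi 0))
      (nhds (∫ t : ℝ in Set.Ioi 0, g 0 * (((t : ℂ) - Complex.I) ^ 2)⁻¹)) := by
    refine tendsto_integral_filter_of_dominated_convergence
      (fun t => M * ‖(((t : ℂ) - Complex.I) ^ 2)⁻¹‖) ?_ ?_ ?_ ?_
    · refine Eventually.of_forall fun ε => Measurable.aestronglyMeasurable ?_
      fun_prop
    · refine Eventually.of_forall fun ε => ae_of_all _ fun t => ?_
      rw [norm_mul]
      exact mul_le_mul_of_nonneg_right (hbound _) (norm_nonneg _)
    · exact (integrable_inv_ofReal_sub_I_sq.norm.const_mul M).integrableOn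
    · refine ae_restrict_of_forall_mem measurableSet_Ioi fun t ht => ?_
      refine (hzero.comp ?_).mul_const _
      refine tendsto_nhdsWithin_iff.2 ⟨?_, ?_⟩
      · exact (Continuous.tendsto' (by fun_prop) 0 0 (by simp)).mono_left nhdsWithin_le_nhds
      · filter_upwards [self_mem_nhdsWithin] with ε hε
        exact mul_pos (Set.mem_Ioi.1 hε) (Set.mem_Ioi.1 ht)
  rw [integral_const_mul, integral_Ioi_inv_ofReal_sub_I_sq] at hlim
  have hvalue : -g 0 = Complex.I * (g 0 * Complex.I) := by
    rw [mul_left_comm, Complex.I_mul_I, mul_neg_one]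
  rw [hvalue]
  refine (hlim.const_mul Complex.I).congr' ?_
  filter_upwards [self_mem_nhdsWithin] with ε hε
  rw [mul_assoc, mul_integral_div_sub_sq_eq_integral_Ioi ha hε]
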